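/- Let Γ be a group, M = M_d(ℂ), p ∈ M a nonzero projection, π : Γ → U(pMp) and ρ : Γ → U(M) unitary representations, and 0 < δ < 1/2. Suppose that for every g ∈ Γ one has ‖π(g)pρ(g)* − p‖_{2,M}/‖p‖_{2,M} ≤ δ. Let K be the convex hull of {π(g)pρ(g)* : g ∈ Γ} in pM and let η be the unique element of K of minimal 2-norm. Then η satisfies: π(g)ηρ(g)* = η for all g ∈ Γ, ‖η‖_op ≤ 1, ‖η − p‖_{2,M}/‖p‖_{2,M} ≤ δ, and the renormalized vector ξ = (‖p‖_{2,M}/‖η‖_{2,M})·η satisfies ‖ξ‖_op ≤ 2 and ‖ξ − p‖_{2,M}/‖p‖_{2,M} ≤ δ² + 2δ. -/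

import Mathlib

open Matrix

/-- normalized Hilbert–Schmidt norm `‖A‖_{2,M}` on `M = M_d(ℂ)` with normalized trace. -/
noncomputable def nHS (d : ℕ) (A : Matrix (Fin d) (Fin d) ℂ) : ℝ :=
  Real.sqrt (((Matrix.trace (Aᴴ * A)).re) / d)

/-- operator norm of a matrix, acting on Euclidean space. -/
noncomputable def matOpNorm (d : ℕ) (A : Matrix (Fin d) (Fin d) ℂ) : ℝ :=
  ‖Matrix.toEuclideanCLM (𝕜 := ℂ) A‖

theorem aux_sep {E : Type*} [NormedAddCommGroup E] [NormedSpace ℝ E] [FiniteDimensional ℝ E]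
    (S : Set E) (h0 : (0 : E) ∈ closure (convexHull ℝ S)) (h1 : (0 : E) ∉ convexHull ℝ S) :
    ∃ f : E →ₗ[ℝ] ℝ, (∀ x ∈ S, 0 ≤ f x) ∧ ∃ x ∈ S, 0 < f x := by
  classical
  set W := Submodule.span ℝ S with hW
  set K' : Set W := W.subtype ⁻¹' (convexHull ℝ S) with hK'
  have hKW : convexHull ℝ S ⊆ (W : Set E) :=
    convexHull_min Submodule.subset_span W.convex
  have hconv : Convex ℝ K' := (convex_convexHull ℝ S).linear_preimage W.subtype
  have him : W.subtype '' K' = convexHull ℝ S := by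
    rw [hK', Set.image_preimage_eq_inter_range]
    simpa using hKW
  have hE0 : (0 : E) ∈ affineSpan ℝ (convexHull ℝ S) :=
    closure_minimal (subset_affineSpan ℝ _) (AffineSubspace.closed_of_finiteDimensional _) h0
  have hspan : affineSpan ℝ K' = ⊤ := by
    have hmap : (affineSpan ℝ K').map W.subtype.toAffineMap = affineSpan ℝ (convexHull ℝ S) := by
      rw [AffineSubspace.map_span]
      congr 1
    have h0' : (0 : W) ∈ affineSpan ℝ K' := by
      rw [← hmap] at hE0
      obtain ⟨w, hw, hw0⟩ := hE0
      have : w = 0 := by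
        apply Subtype.ext
        simpa using hw0
      rwa [this] at hw
    have hle : W ≤ (affineSpan ℝ (convexHull ℝ S)).direction := by
      rw [hW, Submodule.span_le]
      intro x hx
      have := AffineSubspace.vsub_mem_direction
        (subset_affineSpan ℝ _ (subset_convexHull ℝ S hx)) hE0
      simpa using this
    rw [eq_top_iff]
    intro w _
    have hw := AffineSubspace.vadd_mem_of_mem_direction (hle w.2) hE0
    rw [← hmap] at hw
    obtain ⟨v, hv, hv0⟩ := hw
    have : v = w := by
      apply Subtype.ext
      simpa using hv0
    rwa [this] at hv
  have hint : (interior K').Nonempty := hconv.interior_nonempty_iff_affineSpan_eq_top.2 hspan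
  have hn : (0 : W) ∉ interior K' := fun h => h1 (by simpa [hK'] using interior_subset h)
  obtain ⟨f, hf⟩ := geometric_hahn_banach_open_point hconv.interior isOpen_interior hn
  obtain ⟨F, hF⟩ := LinearMap.exists_extend (f : W →ₗ[ℝ] ℝ)
  have hFf : ∀ w : W, F w = f w := fun w => by
    have := LinearMap.congr_fun hF w
    simpa using this
  have hle : ∀ w ∈ K', f w ≤ 0 := by
    intro w hw
    have hcl : w ∈ closure (interior K') := by
      rw [hconv.closure_interior_eq_closure_of_nonempty_interior hint]
      exact subset_closure hw
    have : closure (interior K') ⊆ {w | f w ≤ 0} :=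
      closure_minimal (fun x hx => by have := hf x hx; simp at this; exact this.le)
        (isClosed_le f.continuous continuous_const)
    exact this hcl
  refine ⟨-F, ?_, ?_⟩
  · intro x hx
    have := hle ⟨x, Submodule.subset_span hx⟩ (subset_convexHull ℝ S hx)
    rw [← hFf] at this
    simpa using this
  · by_contra! hcon
    obtain ⟨w, hw⟩ := hint
    have h2 := hf w hw
    have h3 : convexHull ℝ S ⊆ {x | (-F) x ≤ 0} :=
      convexHull_min hcon (convex_halfSpace_le (-F).isLinear 0)
    have hwK : w ∈ K' := interior_subset hw
    have h4 := h3 hwK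
    simp only [Set.mem_ofPred_eq, LinearMap.neg_apply, Submodule.subtype_apply, hFf] at h4
    simp at h2
    linarith

theorem aux_fixed {Γ E : Type*} [Group Γ] [NormedAddCommGroup E] [NormedSpace ℝ E]
    [FiniteDimensional ℝ E]
    (hpar : ∀ x y : E, ‖x + y‖ ^ 2 + ‖x - y‖ ^ 2 = 2 * (‖x‖ ^ 2 + ‖y‖ ^ 2))
    (T : Γ → E →ₗ[ℝ] E) (hT : ∀ g x, ‖T g x‖ ≤ ‖x‖) (y : Γ → E)
    (hy : ∀ h g, T h (y g) = y (h * g)) :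
    ∃ η ∈ convexHull ℝ (Set.range y), (∀ ζ ∈ convexHull ℝ (Set.range y), ‖η‖ ≤ ‖ζ‖) ∧
      (∀ η' ∈ convexHull ℝ (Set.range y),
        (∀ ζ ∈ convexHull ℝ (Set.range y), ‖η'‖ ≤ ‖ζ‖) → η' = η) ∧
      ∀ g, T g η = η := by
  classical
  set K := convexHull ℝ (Set.range y) with hK
  have hKc : Convex ℝ K := convex_convexHull ℝ _
  have hne : (closure K).Nonempty := ⟨y 1, subset_closure (subset_convexHull ℝ _ ⟨1, rfl⟩)⟩
  obtain ⟨η, hη, hmin'⟩ := isClosed_closure.exists_infDist_eq_dist hne (0 : E)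
  have hmin : ∀ ζ ∈ closure K, ‖η‖ ≤ ‖ζ‖ := by
    intro ζ hζ
    have := Metric.infDist_le_dist_of_mem (x := (0 : E)) hζ
    rw [hmin'] at this
    simpa using this
  have huniq : ∀ η' ∈ closure K, ‖η'‖ ≤ ‖η‖ → η' = η := by
    intro η' h1 h2
    have hm : (1 / 2 : ℝ) • η' + (1 / 2 : ℝ) • η ∈ closure K :=
      hKc.closure h1 hη (by norm_num) (by norm_num) (by norm_num)
    have h3 := hmin _ hm
    rw [← smul_add, norm_smul] at h3
    norm_num at h3
    have h4 := hpar η' η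
    have h5 : ‖η' - η‖ ^ 2 ≤ 0 := by
      nlinarith [norm_nonneg η, norm_nonneg η', norm_nonneg (η' + η)]
    have h6 : ‖η' - η‖ = 0 := by
      have := sq_nonneg ‖η' - η‖
      exact pow_eq_zero_iff (two_ne_zero) |>.1 (le_antisymm h5 this)
    exact sub_eq_zero.1 (norm_eq_zero.1 h6)
  have hTcont : ∀ g, Continuous (T g) := fun g => (T g).continuous_of_finiteDimensional
  have hTK : ∀ g, Set.MapsTo (T g) K K := by
    intro g
    have : K ⊆ (T g) ⁻¹' K := by
      apply convexHull_min
      · rintro _ ⟨h, rfl⟩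
        show T g (y h) ∈ K
        rw [hy]
        exact subset_convexHull ℝ _ ⟨_, rfl⟩
      · exact hKc.linear_preimage (T g)
    exact this
  have hfix : ∀ g, T g η = η := fun g =>
    huniq _ ((hTK g).closure (hTcont g) hη) (hT g η)
  have hmem : η ∈ K := by
    by_contra hnot
    set S : Set E := (fun x => x - η) '' Set.range y with hS
    have hSh : convexHull ℝ S = (fun x => x - η) '' K := by
      have h := AffineMap.image_convexHull ((AffineMap.id ℝ E) - AffineMap.const ℝ E η)
        (Set.range y)
      have he : (((AffineMap.id ℝ E) - AffineMap.const ℝ E η : E →ᵃ[ℝ] E) : E → E)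
          = fun x => x - η := by
        ext x
        simp
      rw [he] at h
      exact h.symm
    have hcont : Continuous (fun x : E => x - η) := by fun_prop
    have h0 : (0 : E) ∈ closure (convexHull ℝ S) := by
      rw [hSh]
      exact image_closure_subset_closure_image hcont ⟨η, hη, sub_self η⟩
    have h1 : (0 : E) ∉ convexHull ℝ S := by
      rw [hSh]
      rintro ⟨x, hx, hx0⟩
      exact hnot ((sub_eq_zero.1 hx0) ▸ hx)
    obtain ⟨f, hf, x, ⟨_, ⟨a, rfl⟩, rfl⟩, hpos⟩ := aux_sep S h0 h1
    have hfc : Continuous f := f.continuous_of_finiteDimensional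
    have hfg : ∀ g, f η ≤ f (y g) := by
      intro g
      have := hf (y g - η) ⟨_, ⟨g, rfl⟩, rfl⟩
      simpa using this
    have hfa : f η < f (y a) := by simpa using hpos
    obtain ⟨ε, hε, hball⟩ := Metric.continuousAt_iff.1 (hfc.continuousAt (x := y a))
      ((f (y a) - f η) / 2) (by linarith)
    have htb : TotallyBounded (Set.range y) := by
      refine ((isCompact_closedBall (0 : E) ‖y 1‖).totallyBounded).subset ?_
      rintro _ ⟨g, rfl⟩
      have := hT g (y 1)
      rw [hy, mul_one] at this
      simpa using this
    obtain ⟨t, htS, htf, hcov⟩ := Metric.finite_approx_of_totallyBounded htb ε hε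
    obtain ⟨s, hs⟩ : ∃ s : Finset Γ, ∀ x ∈ t, ∃ k ∈ s, y k = x := by
      have htS' : ∀ x ∈ t, ∃ k, y k = x := fun x hx => htS hx
      choose! φ hφ using htS'
      exact ⟨htf.toFinset.image φ, fun x hx =>
        ⟨φ x, Finset.mem_image_of_mem _ (htf.mem_toFinset.2 hx), hφ x hx⟩⟩
    set F : E →ₗ[ℝ] ℝ := ∑ k ∈ s, f ∘ₗ (T (a * k⁻¹)) with hF
    have hFη : F η = ∑ k ∈ s, f η := by simp [hF, hfix]
    have hFy : ∀ g, F η + (f (y a) - f η) / 2 ≤ F (y g) := by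
      intro g
      have hg := hcov ⟨g, rfl⟩
      simp only [Set.mem_iUnion] at hg
      obtain ⟨x, hx, hgx⟩ := hg
      obtain ⟨k, hk, rfl⟩ := hs x hx
      have hd : dist (y (a * k⁻¹ * g)) (y a) < ε := by
        have := hT (a * k⁻¹) (y g - y k)
        rw [map_sub, hy, hy, inv_mul_cancel_right] at this
        rw [dist_eq_norm]
        rw [Metric.mem_ball, dist_eq_norm] at hgx
        linarith
      have hb := hball hd
      rw [Real.dist_eq, abs_lt] at hb
      have hFy' : F (y g) = ∑ k ∈ s, f (y (a * k⁻¹ * g)) := by simp [hF, hy]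
      have : ∑ k ∈ s, (f (y (a * k⁻¹ * g)) - f η) ≥ f (y (a * k⁻¹ * g)) - f η :=
        Finset.single_le_sum (f := fun k => f (y (a * k⁻¹ * g)) - f η)
          (fun i _ => sub_nonneg.2 (hfg _)) hk
      rw [Finset.sum_sub_distrib] at this
      rw [hFη, hFy']
      linarith [hb.1]
    have hsub : closure K ⊆ {x | F η + (f (y a) - f η) / 2 ≤ F x} := by
      apply closure_minimal
      · apply convexHull_min
        · rintro _ ⟨g, rfl⟩
          exact hFy g
        · exact convex_halfSpace_ge F.isLinear _
      · exact isClosed_le continuous_const F.continuous_of_finiteDimensional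
    have := hsub hη
    simp only [Set.mem_ofPred_eq] at this
    linarith
  exact ⟨η, hmem, fun ζ hζ => hmin ζ (subset_closure hζ),
    fun η' h1 h2 => huniq η' (subset_closure h1) (h2 η hmem), hfix⟩

section MatrixAux

attribute [local instance] Matrix.frobeniusNormedAddCommGroup Matrix.frobeniusNormedSpace

theorem aux_frob_sq (d : ℕ) (A : Matrix (Fin d) (Fin d) ℂ) :
    ‖A‖ ^ 2 = (Matrix.trace (Aᴴ * A)).re := by
  rw [Matrix.frobenius_norm_def, ← Real.sqrt_eq_rpow, Real.sq_sqrt (by positivity)]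
  simp only [Matrix.trace, Matrix.diag, Matrix.mul_apply, Matrix.conjTranspose_apply,
    Complex.re_sum]
  rw [Finset.sum_comm]
  refine Finset.sum_congr rfl fun i _ => Finset.sum_congr rfl fun j _ => ?_
  rw [RCLike.star_def, ← Complex.normSq_eq_conj_mul_self, Complex.ofReal_re,
    Complex.normSq_eq_norm_sq]
  norm_cast

theorem aux_nHS (d : ℕ) (A : Matrix (Fin d) (Fin d) ℂ) :
    nHS d A = ‖A‖ / Real.sqrt d := by
  rw [nHS, ← aux_frob_sq, Real.sqrt_div (by positivity), Real.sqrt_sq (norm_nonneg _)]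

theorem aux_par (d : ℕ) (x y : Matrix (Fin d) (Fin d) ℂ) :
    ‖x + y‖ ^ 2 + ‖x - y‖ ^ 2 = 2 * (‖x‖ ^ 2 + ‖y‖ ^ 2) := by
  simp only [aux_frob_sq, Matrix.conjTranspose_add, Matrix.conjTranspose_sub, add_mul, mul_add,
    sub_mul, mul_sub, Matrix.trace_add, Matrix.trace_sub, Complex.add_re, Complex.sub_re]
  ring

theorem aux_contr (d : ℕ) (p u v x : Matrix (Fin d) (Fin d) ℂ) (hp : p * p = p) (hp' : pᴴ = p)
    (hu : uᴴ * u = p) (hv : vᴴ * v = 1) : ‖u * x * vᴴ‖ ≤ ‖x‖ := by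
  have h1 : ‖u * x * vᴴ‖ ^ 2 = (Matrix.trace (xᴴ * (p * x))).re := by
    rw [aux_frob_sq]
    congr 1
    simp only [Matrix.conjTranspose_mul, Matrix.conjTranspose_conjTranspose]
    rw [← Matrix.mul_assoc, Matrix.trace_mul_comm]
    simp only [← Matrix.mul_assoc, hv, Matrix.one_mul]
    rw [Matrix.mul_assoc xᴴ, hu]
  have h2 : ‖x - p * x‖ ^ 2 = ‖x‖ ^ 2 - (Matrix.trace (xᴴ * (p * x))).re := by
    rw [aux_frob_sq, aux_frob_sq, ← Complex.sub_re, ← Matrix.trace_sub]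
    congr 2
    simp only [Matrix.conjTranspose_sub, Matrix.conjTranspose_mul, hp', sub_mul, mul_sub]
    have : xᴴ * p * (p * x) = xᴴ * (p * x) := by
      rw [Matrix.mul_assoc, ← Matrix.mul_assoc p, hp]
    rw [this, Matrix.mul_assoc xᴴ p x]
    abel
  have h3 : ‖u * x * vᴴ‖ ^ 2 ≤ ‖x‖ ^ 2 := by nlinarith [sq_nonneg ‖x - p * x‖]
  exact (sq_le_sq₀ (norm_nonneg _) (norm_nonneg _)).1 h3

theorem aux_op (d : ℕ) (p x : Matrix (Fin d) (Fin d) ℂ) (hp : p * p = p) (hp' : pᴴ = p)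
    (hx : x * xᴴ = p) : matOpNorm d x ≤ 1 := by
  have key : ∀ z : Matrix (Fin d) (Fin d) ℂ, matOpNorm d (z * zᴴ) = matOpNorm d z ^ 2 := by
    intro z
    unfold matOpNorm
    rw [map_mul, ← Matrix.star_eq_conjTranspose, map_star, sq]
    exact CStarRing.norm_self_mul_star (E := EuclideanSpace ℂ (Fin d) →L[ℂ] EuclideanSpace ℂ (Fin d))
  have h1 := key p
  have h2 := key x
  rw [hp', hp] at h1
  rw [hx] at h2
  have h0 : 0 ≤ matOpNorm d x := norm_nonneg _
  have h0' : 0 ≤ matOpNorm d p := norm_nonneg _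
  have h3 : matOpNorm d p ≤ 1 := by nlinarith
  nlinarith

theorem aux_op_smul (d : ℕ) (c : ℝ) (hc : 0 ≤ c) (x : Matrix (Fin d) (Fin d) ℂ) :
    matOpNorm d (c • x) = c * matOpNorm d x := by
  unfold matOpNorm
  have : c • x = (c : ℂ) • x := by
    ext i j
    simp
  rw [this, map_smul, norm_smul]
  simp [abs_of_nonneg hc]

theorem aux_op_add (d : ℕ) (x y : Matrix (Fin d) (Fin d) ℂ) :
    matOpNorm d (x + y) ≤ matOpNorm d x + matOpNorm d y := by
  unfold matOpNorm
  rw [map_add]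
  exact norm_add_le _ _

theorem aux_op_convex (d : ℕ) : Convex ℝ {x : Matrix (Fin d) (Fin d) ℂ | matOpNorm d x ≤ 1} := by
  intro x hx y hy a b ha hb hab
  simp only [Set.mem_ofPred_eq] at *
  refine (aux_op_add d _ _).trans ?_
  rw [aux_op_smul d a ha, aux_op_smul d b hb]
  nlinarith

theorem aux_main
    {Γ : Type*} [Group Γ] (d : ℕ) (hd : 0 < d)
    (p : Matrix (Fin d) (Fin d) ℂ) (hproj : p * p = p ∧ pᴴ = p) (hp0 : p ≠ 0)
    (π : Γ → Matrix (Fin d) (Fin d) ℂ)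
    (hπmul : ∀ g h, π (g * h) = π g * π h) (hπone : π 1 = p)
    (hπcorner : ∀ g, p * π g = π g ∧ π g * p = π g)
    (hπunit : ∀ g, (π g)ᴴ * π g = p ∧ π g * (π g)ᴴ = p)
    (ρ : Γ →* Matrix.unitaryGroup (Fin d) ℂ)
    (δ : ℝ) (hδ : 0 < δ) (hδ' : δ < 1 / 2)
    (hclose : ∀ g : Γ,
      nHS d (π g * p * ((ρ g : Matrix (Fin d) (Fin d) ℂ))ᴴ - p) / nHS d p ≤ δ)
    (S : Set (Matrix (Fin d) (Fin d) ℂ))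
    (hS : S = {x | ∃ g : Γ, x = π g * p * ((ρ g : Matrix (Fin d) (Fin d) ℂ))ᴴ}) :
    ∃ η ∈ convexHull ℝ S,
      (∀ ζ ∈ convexHull ℝ S, nHS d η ≤ nHS d ζ) ∧
      (∀ η' ∈ convexHull ℝ S, (∀ ζ ∈ convexHull ℝ S, nHS d η' ≤ nHS d ζ) → η' = η) ∧
      (∀ g : Γ, π g * η * ((ρ g : Matrix (Fin d) (Fin d) ℂ))ᴴ = η) ∧
      matOpNorm d η ≤ 1 ∧
      nHS d (η - p) / nHS d p ≤ δ ∧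
      matOpNorm d ((nHS d p / nHS d η : ℝ) • η) ≤ 2 ∧
      nHS d ((nHS d p / nHS d η : ℝ) • η - p) / nHS d p ≤ δ ^ 2 + 2 * δ := by
  obtain ⟨hpp, hps⟩ := hproj
  have hsd : 0 < Real.sqrt d := Real.sqrt_pos.2 (by exact_mod_cast hd)
  have hpn : 0 < ‖p‖ := norm_pos_iff.2 hp0
  have hv : ∀ g, (ρ g : Matrix (Fin d) (Fin d) ℂ)ᴴ * (ρ g : Matrix (Fin d) (Fin d) ℂ) = 1 :=
    fun g => Matrix.UnitaryGroup.star_mul_self (ρ g)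
  set y : Γ → Matrix (Fin d) (Fin d) ℂ :=
    fun g => π g * p * ((ρ g : Matrix (Fin d) (Fin d) ℂ))ᴴ with hy
  have hSy : S = Set.range y := by
    rw [hS]
    ext x
    simp [hy, eq_comm]
  let T : Γ → Matrix (Fin d) (Fin d) ℂ →ₗ[ℝ] Matrix (Fin d) (Fin d) ℂ := fun g =>
    { toFun := fun x => π g * x * ((ρ g : Matrix (Fin d) (Fin d) ℂ))ᴴ
      map_add' := fun a b => by rw [mul_add, add_mul]
      map_smul' := fun c a => by simp }
  have hratio : ∀ a b : Matrix (Fin d) (Fin d) ℂ, nHS d a / nHS d b = ‖a‖ / ‖b‖ := by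
    intro a b
    rw [aux_nHS, aux_nHS, div_div_div_cancel_right₀ hsd.ne']
  have hle : ∀ a b : Matrix (Fin d) (Fin d) ℂ, nHS d a ≤ nHS d b ↔ ‖a‖ ≤ ‖b‖ := by
    intro a b
    rw [aux_nHS, aux_nHS, div_le_div_iff_of_pos_right hsd]
  obtain ⟨η, hη, hmin, huniq, hfix⟩ := aux_fixed (aux_par d) T
    (fun g x => aux_contr d p (π g) _ x hpp hps (hπunit g).1 (hv g)) y (by
      intro h g
      simp only [T, hy, LinearMap.coe_mk, AddHom.coe_mk, hπmul, map_mul,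
        Matrix.UnitaryGroup.mul_val, Matrix.conjTranspose_mul, Matrix.mul_assoc])
  rw [← hSy] at hη hmin huniq
  have hop : matOpNorm d η ≤ 1 := by
    have : convexHull ℝ S ⊆ {x | matOpNorm d x ≤ 1} := by
      apply convexHull_min _ (aux_op_convex d)
      rw [hSy]
      rintro _ ⟨g, rfl⟩
      apply aux_op d p _ hpp hps
      simp only [hy, (hπcorner g).2, Matrix.conjTranspose_mul, Matrix.conjTranspose_conjTranspose]
      rw [Matrix.mul_assoc, ← Matrix.mul_assoc _ _ (π g)ᴴ, hv, Matrix.one_mul, (hπunit g).2]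
    exact this hη
  have hdist : ‖η - p‖ ≤ δ * ‖p‖ := by
    have : convexHull ℝ S ⊆ Metric.closedBall p (δ * ‖p‖) := by
      apply convexHull_min _ (convex_closedBall _ _)
      rw [hSy]
      rintro _ ⟨g, rfl⟩
      rw [Metric.mem_closedBall, dist_eq_norm]
      have := hclose g
      rw [hratio, div_le_iff₀ hpn] at this
      exact this
    have := this hη
    rwa [Metric.mem_closedBall, dist_eq_norm] at this
  have htri : |‖η‖ - ‖p‖| ≤ δ * ‖p‖ := (abs_norm_sub_norm_le _ _).trans hdist
  have hηlow : ‖p‖ ≤ 2 * ‖η‖ := by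
    have := (abs_le.1 htri).1
    nlinarith
  have hηpos : 0 < ‖η‖ := by linarith
  refine ⟨η, hη, fun ζ hζ => (hle _ _).2 (hmin ζ hζ),
    fun η' h1 h2 => huniq η' h1 fun ζ hζ => (hle _ _).1 (h2 ζ hζ), hfix, hop, ?_, ?_, ?_⟩
  · rw [hratio, div_le_iff₀ hpn]
    exact hdist
  · rw [hratio, aux_op_smul d _ (by positivity)]
    have h1 : ‖p‖ / ‖η‖ ≤ 2 := (div_le_iff₀ hηpos).2 hηlow
    have h2 : 0 ≤ ‖p‖ / ‖η‖ := by positivity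
    nlinarith
  · rw [hratio, hratio, div_le_iff₀ hpn]
    have h1 : ‖(‖p‖ / ‖η‖) • η - η‖ = |‖η‖ - ‖p‖| := by
      have : (‖p‖ / ‖η‖) • η - η = ((‖p‖ - ‖η‖) / ‖η‖) • η := by
        rw [sub_div, div_self hηpos.ne', sub_smul, one_smul]
      rw [this, norm_smul, Real.norm_eq_abs, abs_div, abs_of_pos hηpos,
        div_mul_cancel₀ _ hηpos.ne', abs_sub_comm]
    have h2 : ‖(‖p‖ / ‖η‖) • η - p‖ ≤ ‖(‖p‖ / ‖η‖) • η - η‖ + ‖η - p‖ :=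
      norm_sub_le_norm_sub_add_norm_sub _ _ _
    rw [h1] at h2
    nlinarith [sq_nonneg δ]

end MatrixAux

/-- With `K` the closed convex hull of `{π(g)pρ(g)* : g ∈ Γ}` and `η ∈ K` its
unique element of minimal `2`-norm, `η` is a common fixed point, `‖η‖_op ≤ 1`,
`‖η − p‖₂/‖p‖₂ ≤ δ`, and the renormalization `ξ = (‖p‖₂/‖η‖₂)η` satisfies `‖ξ‖_op ≤ 2` and
`‖ξ − p‖₂/‖p‖₂ ≤ δ² + 2δ`. -/
theorem minimal_norm_intertwiner
    {Γ : Type*} [Group Γ] (d : ℕ) (hd : 0 < d)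
    (p : Matrix (Fin d) (Fin d) ℂ) (hproj : p * p = p ∧ pᴴ = p) (hp0 : p ≠ 0)
    (π : Γ → Matrix (Fin d) (Fin d) ℂ)
    (hπmul : ∀ g h, π (g * h) = π g * π h) (hπone : π 1 = p)
    (hπcorner : ∀ g, p * π g = π g ∧ π g * p = π g)
    (hπunit : ∀ g, (π g)ᴴ * π g = p ∧ π g * (π g)ᴴ = p)
    (ρ : Γ →* Matrix.unitaryGroup (Fin d) ℂ)
    (δ : ℝ) (hδ : 0 < δ) (hδ' : δ < 1 / 2)
    (hclose : ∀ g : Γ,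
      nHS d (π g * p * ((ρ g : Matrix (Fin d) (Fin d) ℂ))ᴴ - p) / nHS d p ≤ δ) :
    ∃ η ∈ convexHull ℝ {x : Matrix (Fin d) (Fin d) ℂ |
        ∃ g : Γ, x = π g * p * ((ρ g : Matrix (Fin d) (Fin d) ℂ))ᴴ},
      (∀ ζ ∈ convexHull ℝ {x : Matrix (Fin d) (Fin d) ℂ |
          ∃ g : Γ, x = π g * p * ((ρ g : Matrix (Fin d) (Fin d) ℂ))ᴴ}, nHS d η ≤ nHS d ζ) ∧
      (∀ η' ∈ convexHull ℝ {x : Matrix (Fin d) (Fin d) ℂ |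
          ∃ g : Γ, x = π g * p * ((ρ g : Matrix (Fin d) (Fin d) ℂ))ᴴ},
        (∀ ζ ∈ convexHull ℝ {x : Matrix (Fin d) (Fin d) ℂ |
          ∃ g : Γ, x = π g * p * ((ρ g : Matrix (Fin d) (Fin d) ℂ))ᴴ}, nHS d η' ≤ nHS d ζ)
          → η' = η) ∧
      (∀ g : Γ, π g * η * ((ρ g : Matrix (Fin d) (Fin d) ℂ))ᴴ = η) ∧
      matOpNorm d η ≤ 1 ∧
      nHS d (η - p) / nHS d p ≤ δ ∧
      matOpNorm d ((nHS d p / nHS d η : ℝ) • η) ≤ 2 ∧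
      nHS d ((nHS d p / nHS d η : ℝ) • η - p) / nHS d p ≤ δ ^ 2 + 2 * δ := by
  exact aux_main d hd p hproj hp0 π hπmul hπone hπcorner hπunit ρ δ hδ hδ' hclose _ rfl
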